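/- There exists a constant c > 0 such that for every y ∈ ℝ with y ≠ 0, one has (1 + y²)·g(y)/y⁴ ≤ −c, where g(y) = ln cosh y − y²/2. Equivalently, the function h defined on ℝ∖{0} by h(y) = (1+y²)·g(y)/y⁴ is negative, extends to a continuous function on ℝ with h(0) = −1/12, tends to −1/2 as |y| → ∞, and is bounded above by some −c with c > 0. -/

import Mathlib

open Filter Topology

/-- The function `g(y) = ln cosh y − y²/2`. -/
noncomputable def g (y : ℝ) : ℝ := Real.log (Real.cosh y) - y ^ 2 / 2

/-- The function `h(y) = (1 + y²) g(y) / y⁴` extended by continuity at `0` with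
`h(0) = −1/12`. -/
noncomputable def h (y : ℝ) : ℝ := if y = 0 then -(1/12) else (1 + y ^ 2) * g y / y ^ 4

lemma nonneg_of_hasDerivAt_nonneg {f f' : ℝ → ℝ} (h0 : f 0 = 0)
    (hf : ∀ y, HasDerivAt f (f' y) y) (hf' : ∀ y, 0 ≤ y → 0 ≤ f' y) {y : ℝ} (hy : 0 ≤ y) :
    0 ≤ f y := by
  have hmono : MonotoneOn f (Set.Ici 0) := by
    refine monotoneOn_of_deriv_nonneg (convex_Ici 0)
      (fun x _ => (hf x).continuousAt.continuousWithinAt)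
      (fun x _ => (hf x).differentiableAt.differentiableWithinAt) fun x hx => ?_
    rw [interior_Ici] at hx
    rw [(hf x).deriv]
    exact hf' x hx.le
  simpa [h0] using hmono Set.self_mem_Ici hy hy

lemma sinh_le_mul_cosh {y : ℝ} (hy : 0 ≤ y) : Real.sinh y ≤ y * Real.cosh y := by
  have := nonneg_of_hasDerivAt_nonneg (f := fun y => y * Real.cosh y - Real.sinh y)
    (f' := fun y => y * Real.sinh y) (by simp)
    (fun y => (((hasDerivAt_id y).mul (Real.hasDerivAt_cosh y)).sub
      (Real.hasDerivAt_sinh y)).congr_deriv (by simp))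
    (fun y hy => mul_nonneg hy (Real.sinh_nonneg_iff.2 hy)) hy
  linarith

lemma mul_sinh_le_mul_cosh {y : ℝ} (hy : 0 ≤ y) :
    3 * (1 + y ^ 2) * Real.sinh y ≤ (3 * y + 2 * y ^ 3) * Real.cosh y := by
  have := nonneg_of_hasDerivAt_nonneg
    (f := fun y => (3 * y + 2 * y ^ 3) * Real.cosh y - 3 * (1 + y ^ 2) * Real.sinh y)
    (f' := fun y => y * (3 * (y * Real.cosh y - Real.sinh y) + 2 * y ^ 2 * Real.sinh y))
    (by simp)
    (fun y => ((((((hasDerivAt_id y).const_mul 3).add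
      ((hasDerivAt_pow 3 y).const_mul 2)).mul (Real.hasDerivAt_cosh y)).sub
      ((((hasDerivAt_pow 2 y).const_add 1).const_mul 3).mul
        (Real.hasDerivAt_sinh y)))).congr_deriv (by simp; ring))
    (fun y hy => by
      have h1 := sub_nonneg.2 (sinh_le_mul_cosh hy)
      have h2 := Real.sinh_nonneg_iff.2 hy
      positivity) hy
  linarith

lemma mul_cosh_le_sinh {y : ℝ} (hy : 0 ≤ y) :
    (y - y ^ 3 / 3) * Real.cosh y ≤ Real.sinh y := by
  have := nonneg_of_hasDerivAt_nonneg
    (f := fun y => Real.sinh y - (y - y ^ 3 / 3) * Real.cosh y)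
    (f' := fun y => y * (y * Real.cosh y - Real.sinh y) + y ^ 3 / 3 * Real.sinh y)
    (by simp)
    (fun y => ((Real.hasDerivAt_sinh y).sub (((hasDerivAt_id y).sub
      ((hasDerivAt_pow 3 y).div_const 3)).mul (Real.hasDerivAt_cosh y))).congr_deriv
        (by simp; ring))
    (fun y hy => by
      have h1 := sub_nonneg.2 (sinh_le_mul_cosh hy)
      have h2 := Real.sinh_nonneg_iff.2 hy
      positivity) hy
  linarith

lemma hasDerivAt_g (y : ℝ) : HasDerivAt g (Real.sinh y / Real.cosh y - y) y :=
  (((Real.hasDerivAt_cosh y).log (Real.cosh_pos y).ne').sub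
    ((hasDerivAt_pow 2 y).div_const 2)).congr_deriv (by simp)

lemma g_zero : g 0 = 0 := by simp [g]

lemma g_abs (y : ℝ) : g |y| = g y := by simp [g]

lemma neg_pow_four_div_le_g (y : ℝ) : -(y ^ 4 / 12) ≤ g y := by
  have := nonneg_of_hasDerivAt_nonneg
    (f := fun y => g y + y ^ 4 / 12)
    (f' := fun y => Real.sinh y / Real.cosh y - (y - y ^ 3 / 3))
    (by simp [g_zero])
    (fun y => ((hasDerivAt_g y).add ((hasDerivAt_pow 4 y).div_const 12)).congr_deriv
      (by norm_num; ring))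
    (fun y hy => sub_nonneg.2 ((le_div_iff₀ (Real.cosh_pos y)).2 (mul_cosh_le_sinh hy)))
    (abs_nonneg y)
  simp only [g_abs, Even.pow_abs (by decide : Even 4)] at this
  linarith

lemma g_le_neg_pow_four_div (y : ℝ) : g y ≤ -(y ^ 4 / (12 * (1 + y ^ 2))) := by
  have := nonneg_of_hasDerivAt_nonneg
    (f := fun y => -(y ^ 4 / (12 * (1 + y ^ 2))) - g y)
    (f' := fun y => ((3 * y + 2 * y ^ 3) / (3 * (1 + y ^ 2)) - Real.sinh y / Real.cosh y) +
      y ^ 5 / (6 * (1 + y ^ 2) ^ 2))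
    (by simp [g_zero])
    (fun y => ((((hasDerivAt_pow 4 y).div (((hasDerivAt_pow 2 y).const_add 1).const_mul 12)
      (by positivity)).neg).sub (hasDerivAt_g y)).congr_deriv
      (by
        have := (Real.cosh_pos y).ne'
        norm_num
        field_simp
        ring))
    (fun y hy => by
      have h1 : Real.sinh y / Real.cosh y ≤ (3 * y + 2 * y ^ 3) / (3 * (1 + y ^ 2)) := by
        rw [div_le_div_iff₀ (Real.cosh_pos y) (by positivity), mul_comm]
        exact mul_sinh_le_mul_cosh hy
      have h2 := sub_nonneg.2 h1
      positivity)
    (abs_nonneg y)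
  simp only [g_abs, Even.pow_abs (by decide : Even 4), sq_abs] at this
  linarith

lemma h_le (y : ℝ) : h y ≤ -(1 / 12) := by
  rcases eq_or_ne y 0 with rfl | hy
  · simp [h]
  · have hy4 : 0 < y ^ 4 := by positivity
    rw [h, if_neg hy, div_le_iff₀ hy4]
    calc (1 + y ^ 2) * g y ≤ (1 + y ^ 2) * -(y ^ 4 / (12 * (1 + y ^ 2))) :=
          mul_le_mul_of_nonneg_left (g_le_neg_pow_four_div y) (by positivity)
      _ = -(1 / 12) * y ^ 4 := by field_simp

lemma le_h (y : ℝ) : -((1 + y ^ 2) / 12) ≤ h y := by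
  rcases eq_or_ne y 0 with rfl | hy
  · simp [h]
  · have hy4 : 0 < y ^ 4 := by positivity
    rw [h, if_neg hy, le_div_iff₀ hy4]
    calc -((1 + y ^ 2) / 12) * y ^ 4 = (1 + y ^ 2) * -(y ^ 4 / 12) := by ring
      _ ≤ (1 + y ^ 2) * g y :=
          mul_le_mul_of_nonneg_left (neg_pow_four_div_le_g y) (by positivity)

lemma h_abs (y : ℝ) : h |y| = h y := by
  simp [h, g_abs, Even.pow_abs (by decide : Even 4)]

lemma continuous_h : Continuous h := by
  rw [continuous_iff_continuousAt]
  intro y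
  rcases eq_or_ne y 0 with rfl | hy
  · have h0 : h 0 = -(1 / 12) := by simp [h]
    rw [ContinuousAt, h0]
    refine tendsto_of_tendsto_of_tendsto_of_le_of_le ?_ tendsto_const_nhds le_h h_le
    have : Continuous fun y : ℝ => -((1 + y ^ 2) / 12) := by fun_prop
    simpa using this.tendsto 0
  · have hc : ContinuousAt (fun y => (1 + y ^ 2) * g y / y ^ 4) y :=
      ((by fun_prop : ContinuousAt (fun y : ℝ => 1 + y ^ 2) y).mul
        (hasDerivAt_g y).continuousAt).div (by fun_prop) (by positivity)
    refine hc.congr ?_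
    filter_upwards [eventually_ne_nhds hy] with x hx
    rw [h, if_neg hx]

lemma log_cosh_le {y : ℝ} (hy : 0 ≤ y) : Real.log (Real.cosh y) ≤ y := by
  rw [Real.log_le_iff_le_exp (Real.cosh_pos y), ← Real.cosh_add_sinh]
  exact le_add_of_nonneg_right (Real.sinh_nonneg_iff.2 hy)

lemma tendsto_h_atTop : Tendsto h atTop (𝓝 (-(1 / 2))) := by
  have hlog : Tendsto (fun y : ℝ => Real.log (Real.cosh y) * y⁻¹ ^ 2) atTop (𝓝 0) := by
    refine tendsto_of_tendsto_of_tendsto_of_le_of_le' tendsto_const_nhds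
      tendsto_inv_atTop_zero ?_ ?_
    · exact Eventually.of_forall fun y =>
        mul_nonneg (Real.log_nonneg (Real.one_le_cosh y)) (by positivity)
    · filter_upwards [eventually_gt_atTop 0] with y hy
      calc Real.log (Real.cosh y) * y⁻¹ ^ 2 ≤ y * y⁻¹ ^ 2 :=
            mul_le_mul_of_nonneg_right (log_cosh_le hy.le) (by positivity)
        _ = y⁻¹ := by field_simp
  have hlim := (((tendsto_inv_atTop_zero (𝕜 := ℝ)).pow 2).const_add 1).mul
    (hlog.sub_const (1 / 2))
  norm_num at hlim
  norm_num
  refine hlim.congr' ?_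
  filter_upwards [eventually_ne_atTop 0] with y hy
  rw [h, if_neg hy, g]
  field_simp
  ring

lemma tendsto_h_cocompact : Tendsto h (cocompact ℝ) (𝓝 (-(1 / 2))) :=
  (tendsto_h_atTop.comp (tendsto_norm_cocompact_atTop (E := ℝ))).congr h_abs

/-- there exists `c > 0` with `(1 + y²) g(y) / y⁴ ≤ −c` for all `y ≠ 0`.
Equivalently, `h` is negative, is a continuous extension (with `h 0 = −1/12`) of
`y ↦ (1 + y²) g(y) / y⁴`, tends to `−1/2` at infinity, and is bounded above by `−c`. -/
theorem h_le_neg_const :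
    (∃ c : ℝ, 0 < c ∧ ∀ y : ℝ, y ≠ 0 → (1 + y ^ 2) * g y / y ^ 4 ≤ -c) ∧
    (∀ y : ℝ, h y < 0) ∧
    Continuous h ∧ h 0 = -(1/12) ∧
    Tendsto h (cocompact ℝ) (𝓝 (-(1/2))) := by
  refine ⟨⟨1 / 12, by norm_num, fun y hy => ?_⟩, fun y => (h_le y).trans_lt (by norm_num),
    continuous_h, by simp [h], tendsto_h_cocompact⟩
  simpa only [h, if_neg hy] using h_le y
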